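/- For every nonzero q ∈ ℤ[i] and every x ∈ ℤ[i]: τ_q(x) = μ(q/d) · φ(q)/φ(q/d), where d = gcd(q, x̄) (taken up to units). -/

import Mathlib

open Complex GaussianInt MeasureTheory
open scoped Real ENNReal

noncomputable section
attribute [local instance] Classical.propDecidable

/-- The real inner product on `ℂ ≅ ℝ²`: `⟨z, w⟩ = Re z · Re w + Im z · Im w`. -/
def cip (z w : ℂ) : ℝ := z.re * w.re + z.im * w.im

/-- `e(t) = exp(2πit)`. -/
def e2 (t : ℝ) : ℂ := Complex.exp (2 * Real.pi * Complex.I * t)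

/-- The fundamental box `B_q` of residues modulo `q`:
`B_q = {r : 0 ≤ ⟨r,q⟩ < N(q), 0 ≤ ⟨r,iq⟩ < N(q)}`. -/
def Bq (q : GaussianInt) : Set GaussianInt :=
  {r | 0 ≤ cip (toComplex r) (toComplex q) ∧
       cip (toComplex r) (toComplex q) < Complex.normSq (toComplex q) ∧
       0 ≤ cip (toComplex r) (Complex.I * toComplex q) ∧
       cip (toComplex r) (Complex.I * toComplex q) < Complex.normSq (toComplex q)}

/-- `𝔸_q`, the reduced residues in `B_q` (gcd with `q` a unit). -/
def Aq (q : GaussianInt) : Set GaussianInt :=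
  {r | r ∈ Bq q ∧ IsUnit (EuclideanDomain.gcd r q)}

/-- The Euler totient on `ℤ[i]`: `φ(q) = |𝔸_q|`. -/
def gphi (q : GaussianInt) : ℕ := Nat.card (Aq q)

/-- The Gaussian Ramanujan sum `τ_q(x) = Σ_{n ∈ 𝔸_q} e(⟨x, n/q⟩)`. -/
def gtau (q x : GaussianInt) : ℂ :=
  ∑' n : Aq q, e2 (cip (toComplex x) (toComplex (n : GaussianInt) / toComplex q))

/-- The Möbius function on `ℤ[i]`: `(-1)^k` on squarefree numbers with `k`
pairwise non-associate prime factors (so `1` on units), and `0` otherwise. -/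
def gmu (n : GaussianInt) : ℤ :=
  if n ≠ 0 ∧ Squarefree n then (-1) ^ (UniqueFactorizationMonoid.factors n).card else 0

/-- The von Mangoldt function on `ℤ[i]`: `Λ(n) = log N(ρ)` if `n` is a unit times
`ρ^k` for a Gaussian prime `ρ` and `k ≥ 1`, and `0` otherwise. -/
def gvm (n : GaussianInt) : ℝ :=
  if h : ∃ ρ : GaussianInt, Irreducible ρ ∧
      ∃ k : ℕ, 1 ≤ k ∧ ∃ u : GaussianInt, IsUnit u ∧ n = u * ρ ^ k
  then Real.log (Complex.normSq (toComplex h.choose)) else 0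

/-- `ω ⊆ 𝕋 = ℝ/2πℤ` is an interval (arc) of length `l`. -/
def IsArc (ω : Set Real.Angle) (l : ℝ) : Prop :=
  ∃ a : ℝ, ω = (fun θ : ℝ => (θ : Real.Angle)) '' Set.Ico a (a + l)

/-- `arg z ∈ ω`, as a condition in `𝕋`. -/
def argIn (z : ℂ) (ω : Set Real.Angle) : Prop := (↑(Complex.arg z) : Real.Angle) ∈ ω

/-- The normalized sector average kernel `M_N^ω`. -/
def Msec (ω : Set Real.Angle) (l : ℝ) (N : ℕ) (n : GaussianInt) : ℝ :=
  if Zsqrtd.norm n < (N : ℤ) ∧ argIn (toComplex n) ω then 2 * Real.pi / (l * N) else 0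

/-- The weighted sector average kernel `A_N^ω` (with von Mangoldt weights). -/
def Asec (ω : Set Real.Angle) (l : ℝ) (N : ℕ) (n : GaussianInt) : ℂ :=
  if Zsqrtd.norm n < (N : ℤ) ∧ argIn (toComplex n) ω then
    ((2 * Real.pi / (l * N) : ℝ) : ℂ) * (gvm n : ℂ) else 0

/-- The canonical representative of a nonzero associate class in `ℤ[i]`. -/
def IsCanon (z : GaussianInt) : Prop := 0 < z.re ∧ 0 ≤ z.im

/-- `Φ(a, q) = τ_q(a)/φ(q)`. -/
def Phi (a q : GaussianInt) : ℂ := gtau q a / (gphi q : ℂ)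

/-- `Â_N^ω(α)`: the Fourier transform of the weighted sector average. -/
def Ahat (ω : Set Real.Angle) (l : ℝ) (N : ℕ) (α : ℂ) : ℂ :=
  ((2 * Real.pi / (l * N) : ℝ) : ℂ) *
    ∑' n : {m : GaussianInt // Zsqrtd.norm m < (N : ℤ) ∧ argIn (toComplex m) ω},
      (gvm (n : GaussianInt) : ℂ) * e2 (cip (toComplex (n : GaussianInt)) α)

/-- `M̂_N^ω(β)`: the Fourier transform of the sector average. -/
def Mhat (ω : Set Real.Angle) (l : ℝ) (N : ℕ) (β : ℂ) : ℂ :=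
  ((2 * Real.pi / (l * N) : ℝ) : ℂ) *
    ∑' n : {m : GaussianInt // Zsqrtd.norm m < (N : ℤ) ∧ argIn (toComplex m) ω},
      e2 (cip (toComplex (n : GaussianInt)) β)

/-- The tensor Fejér-type bump `η(ξ₁+iξ₂) = (1-|ξ₁|)₊ (1-|ξ₂|)₊`. -/
def eta (ξ : ℂ) : ℝ := max 0 (1 - |ξ.re|) * max 0 (1 - |ξ.im|)

/-- `Δ_s(ξ) = η(16^s ξ)`. -/
def Delta (s : ℕ) (ξ : ℂ) : ℝ := eta ((16 : ℂ) ^ s * ξ)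

/-- `Δ̌_{q₀}(n) = ∫_{[-1/2,1/2)²} Δ_{q₀}(ξ) e(⟨n, ξ⟩) dξ`. -/
def DeltaCheck (q₀ : ℕ) (n : GaussianInt) : ℂ :=
  ∫ p in (Set.Ico (-(1:ℝ)/2) (1/2)) ×ˢ (Set.Ico (-(1:ℝ)/2) (1/2)),
    ((Delta q₀ ((p.1 : ℂ) + (p.2 : ℂ) * Complex.I) : ℝ) : ℂ) *
      e2 (cip (toComplex n) ((p.1 : ℂ) + (p.2 : ℂ) * Complex.I))

/-- The Low part `Lo_{Q,N}^ω` with `Q = 2^{q₀}`. -/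
def Lo (ω : Set Real.Angle) (l : ℝ) (N : ℕ) (q₀ : ℕ) (x : GaussianInt) : ℂ :=
  (∑' y : GaussianInt, ((Msec ω l N y : ℝ) : ℂ) * DeltaCheck q₀ (x - y)) *
    ∑' q : {q : GaussianInt // IsCanon q ∧ (Zsqrtd.norm q : ℝ) < 2 ^ q₀},
      ∑' a : Aq (q : GaussianInt),
        Phi (a : GaussianInt) (star (q : GaussianInt)) *
          e2 (cip (toComplex x) (toComplex (a : GaussianInt) / toComplex (q : GaussianInt)))

/-- Distance from `β ∈ ℂ` to the nearest Gaussian integer. -/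
def distZi (β : ℂ) : ℝ := Metric.infDist β (Set.range fun n : GaussianInt => toComplex n)

/-- `q` is `Q`-smooth: squarefree with all prime factors of norm at most `Q`. -/
def QSmooth (Q : ℝ) (q : GaussianInt) : Prop :=
  Squarefree q ∧ ∀ ρ : GaussianInt, Irreducible ρ → ρ ∣ q → (Zsqrtd.norm ρ : ℝ) ≤ Q


/-- The representative of `r` modulo `q` in the box `B_q`. -/
def boxRep (q r : GaussianInt) : GaussianInt :=
  r - q * ⟨(r * star q).re / q.norm, (r * star q).im / q.norm⟩

theorem mul_star_eq_norm (q : GaussianInt) : q * star q = ((q.norm : ℤ) : GaussianInt) :=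
  (Zsqrtd.norm_eq_mul_conj q).symm

theorem mem_Bq_iff {q r : GaussianInt} :
    r ∈ Bq q ↔ (0 ≤ (r * star q).re ∧ (r * star q).re < q.norm) ∧
      (0 ≤ (r * star q).im ∧ (r * star q).im < q.norm) := by
  have hre : cip (toComplex r) (toComplex q) = (((r * star q).re : ℤ) : ℝ) := by
    simp only [cip, Zsqrtd.re_mul, Zsqrtd.re_star, Zsqrtd.im_star,
      ← GaussianInt.intCast_re, ← GaussianInt.intCast_im]
    push_cast
    ring
  have him : cip (toComplex r) (Complex.I * toComplex q) = (((r * star q).im : ℤ) : ℝ) := by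
    simp only [cip, Complex.I_mul_re, Complex.I_mul_im, Zsqrtd.im_mul, Zsqrtd.re_star,
      Zsqrtd.im_star, ← GaussianInt.intCast_re, ← GaussianInt.intCast_im]
    push_cast
    ring
  simp only [Bq, Set.mem_ofPred_eq, hre, him, ← intCast_real_norm]
  norm_cast
  tauto

theorem boxRep_mul_star (q r : GaussianInt) :
    boxRep q r * star q = ⟨(r * star q).re % q.norm, (r * star q).im % q.norm⟩ := by
  have h : boxRep q r * star q = r * star q -
      (q * star q) * ⟨(r * star q).re / q.norm, (r * star q).im / q.norm⟩ := by
    rw [boxRep]; ring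
  rw [h, mul_star_eq_norm]
  ext
  · simp only [Zsqrtd.re_sub, Zsqrtd.re_smul, Int.emod_def]
  · simp only [Zsqrtd.im_sub, Zsqrtd.im_smul, Int.emod_def]

theorem boxRep_mem {q : GaussianInt} (hq : q ≠ 0) (r : GaussianInt) : boxRep q r ∈ Bq q := by
  have hN := GaussianInt.norm_pos.2 hq
  rw [mem_Bq_iff, boxRep_mul_star]
  exact ⟨⟨Int.emod_nonneg _ hN.ne', Int.emod_lt_of_pos _ hN⟩,
    ⟨Int.emod_nonneg _ hN.ne', Int.emod_lt_of_pos _ hN⟩⟩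

theorem dvd_sub_boxRep (q r : GaussianInt) : q ∣ r - boxRep q r :=
  ⟨_, by rw [boxRep, sub_sub_cancel]⟩

theorem star_ne_zero_of_ne_zero {q : GaussianInt} (hq : q ≠ 0) : star q ≠ 0 :=
  fun h => hq (by simpa using congrArg star h)

theorem boxRep_eq_iff {q : GaussianInt} (hq : q ≠ 0) {r s : GaussianInt} :
    boxRep q r = boxRep q s ↔ q ∣ r - s := by
  constructor
  · intro h
    have := dvd_sub (dvd_sub_boxRep q r) (dvd_sub_boxRep q s)
    rwa [h, sub_sub_sub_cancel_right] at this
  · rintro ⟨k, hk⟩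
    apply mul_right_cancel₀ (star_ne_zero_of_ne_zero hq)
    have h : r * star q = s * star q + ((q.norm : ℤ) : GaussianInt) * k := by
      rw [← mul_star_eq_norm, eq_add_of_sub_eq hk]; ring
    rw [boxRep_mul_star, boxRep_mul_star, h]
    ext <;> simp [-Zsqrtd.re_mul, -Zsqrtd.im_mul, Zsqrtd.re_smul, Zsqrtd.im_smul]

theorem boxRep_of_mem {q r : GaussianInt} (hq : q ≠ 0) (hr : r ∈ Bq q) : boxRep q r = r := by
  apply mul_right_cancel₀ (star_ne_zero_of_ne_zero hq)
  obtain ⟨⟨h1, h2⟩, h3, h4⟩ := mem_Bq_iff.1 hr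
  rw [boxRep_mul_star]
  ext
  · exact Int.emod_eq_of_lt h1 h2
  · exact Int.emod_eq_of_lt h3 h4

theorem eq_of_mem_Bq_of_dvd_sub {q r s : GaussianInt} (hq : q ≠ 0) (hr : r ∈ Bq q)
    (hs : s ∈ Bq q) (h : q ∣ r - s) : r = s := by
  rw [← boxRep_of_mem hq hr, ← boxRep_of_mem hq hs, boxRep_eq_iff hq]
  exact h

theorem finite_Bq {q : GaussianInt} (hq : q ≠ 0) : (Bq q).Finite := by
  apply Set.Finite.of_injOn (f := fun r => ((r * star q).re, (r * star q).im))
    (t := Set.Ico 0 q.norm ×ˢ Set.Ico 0 q.norm) (fun r hr => mem_Bq_iff.1 hr) _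
    ((Set.finite_Ico _ _).prod (Set.finite_Ico _ _))
  intro r _ s _ h
  apply mul_right_cancel₀ (star_ne_zero_of_ne_zero hq)
  exact Zsqrtd.ext (congrArg Prod.fst h) (congrArg Prod.snd h)

/-- The box `B_q` as a finite set (empty for `q = 0`). -/
def box (q : GaussianInt) : Finset GaussianInt :=
  if hq : q ≠ 0 then (finite_Bq hq).toFinset else ∅

theorem mem_box {q : GaussianInt} (hq : q ≠ 0) {r : GaussianInt} : r ∈ box q ↔ r ∈ Bq q := by
  simp [box, hq]

/-- `f` only depends on the residue class modulo `q`. -/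
def PeriodicMod (q : GaussianInt) (f : GaussianInt → ℂ) : Prop :=
  ∀ r s, q ∣ r - s → f r = f s

/-- A sum over a set of incongruent elements that represents the support of a periodic function
equals the sum over the box. -/
theorem sum_eq_sum_box {ι : Type*} {q : GaussianInt} (hq : q ≠ 0) {f : GaussianInt → ℂ}
    (hf : PeriodicMod q f) (s : Finset ι) (h : ι → GaussianInt)
    (hinj : ∀ i ∈ s, ∀ j ∈ s, q ∣ h i - h j → i = j)
    (hsurj : ∀ r, f r ≠ 0 → ∃ i ∈ s, q ∣ r - h i) :
    ∑ i ∈ s, f (h i) = ∑ b ∈ box q, f b := by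
  apply Finset.sum_of_injOn (fun i => boxRep q (h i))
  · intro i hi j hj hij
    exact hinj i hi j hj ((boxRep_eq_iff hq).1 hij)
  · intro i _
    exact (mem_box hq).2 (boxRep_mem hq _)
  · intro b hb hb'
    by_contra hne
    obtain ⟨i, hi, hd⟩ := hsurj b hne
    refine hb' ⟨i, hi, ?_⟩
    rw [← boxRep_of_mem hq ((mem_box hq).1 hb)]
    exact ((boxRep_eq_iff hq).2 hd).symm
  · intro i _
    exact hf _ _ (dvd_sub_boxRep q (h i))

theorem exists_mem_box_dvd_sub {q : GaussianInt} (hq : q ≠ 0) (r : GaussianInt) :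
    ∃ b ∈ box q, q ∣ r - b :=
  ⟨boxRep q r, (mem_box hq).2 (boxRep_mem hq r), dvd_sub_boxRep q r⟩

theorem eq_of_mem_box_of_dvd_sub {q : GaussianInt} (hq : q ≠ 0) {r s : GaussianInt}
    (hr : r ∈ box q) (hs : s ∈ box q) (h : q ∣ r - s) : r = s :=
  eq_of_mem_Bq_of_dvd_sub hq ((mem_box hq).1 hr) ((mem_box hq).1 hs) h

theorem sum_box_add {q : GaussianInt} (hq : q ≠ 0) {f : GaussianInt → ℂ}
    (hf : PeriodicMod q f) (t : GaussianInt) :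
    ∑ b ∈ box q, f (b + t) = ∑ b ∈ box q, f b := by
  apply sum_eq_sum_box hq hf (box q) (· + t)
  · intro i hi j hj h
    exact eq_of_mem_box_of_dvd_sub hq hi hj (by simpa using h)
  · intro r _
    obtain ⟨b, hb, h⟩ := exists_mem_box_dvd_sub hq (r - t)
    exact ⟨b, hb, by rwa [sub_sub, add_comm] at h⟩

theorem sum_box_mul {q : GaussianInt} (hq : q ≠ 0) {f : GaussianInt → ℂ}
    (hf : PeriodicMod q f) {u : GaussianInt} (hu : IsCoprime u q) :
    ∑ b ∈ box q, f (u * b) = ∑ b ∈ box q, f b := by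
  apply sum_eq_sum_box hq hf (box q) (u * ·)
  · intro i hi j hj h
    simp only [← mul_sub] at h
    exact eq_of_mem_box_of_dvd_sub hq hi hj (hu.symm.dvd_of_dvd_mul_left h)
  · intro r _
    obtain ⟨a, c, hac⟩ := hu
    obtain ⟨b, hb, h⟩ := exists_mem_box_dvd_sub hq (a * r)
    refine ⟨b, hb, ?_⟩
    have : r - u * b = q * (c * r) + u * (a * r - b) := by linear_combination (-r) * hac
    rw [this]
    exact dvd_add (dvd_mul_right _ _) (h.mul_left _)

theorem sum_box_prod {d m : GaussianInt} (hd : d ≠ 0) (hm : m ≠ 0) {f : GaussianInt → ℂ}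
    (hf : PeriodicMod m f) :
    ∑ b ∈ box (d * m), f b = (box d).card * ∑ b ∈ box m, f b := by
  have hper : PeriodicMod (d * m) f := fun r s h => hf r s (dvd_of_mul_left_dvd h)
  rw [← sum_eq_sum_box (mul_ne_zero hd hm) hper (box d ×ˢ box m) (fun p => m * p.1 + p.2),
    Finset.sum_product]
  · have h : ∀ a ∈ box d, ∑ b ∈ box m, f (m * a + b) = ∑ b ∈ box m, f b := fun a _ =>
      Finset.sum_congr rfl fun b _ => hf _ _ ⟨a, by ring⟩
    rw [Finset.sum_congr rfl h, Finset.sum_const, nsmul_eq_mul]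
  · rintro ⟨a, b⟩ hab ⟨a', b'⟩ hab' h
    rw [Finset.mem_product] at hab hab'
    simp only at h hab hab'
    have hb : b = b' := by
      apply eq_of_mem_box_of_dvd_sub hm hab.2 hab'.2
      have := (dvd_of_mul_left_dvd h).sub (dvd_mul_right m (a - a'))
      convert this using 1; ring
    subst hb
    have ha : a = a' := by
      apply eq_of_mem_box_of_dvd_sub hd hab.1 hab'.1
      rw [add_sub_add_right_eq_sub, ← mul_sub, mul_comm d] at h
      exact (mul_dvd_mul_iff_left hm).1 h
    rw [ha]
  · intro r _
    obtain ⟨b, hb, k, hk⟩ := exists_mem_box_dvd_sub hm r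
    obtain ⟨a, ha, l, hl⟩ := exists_mem_box_dvd_sub hd k
    exact ⟨(a, b), Finset.mem_product.2 ⟨ha, hb⟩, l, by
      simp only; linear_combination hk + m * hl⟩

/-- The sum of `f` over the reduced residues in `B_q`. -/
def redSum (q : GaussianInt) (f : GaussianInt → ℂ) : ℂ :=
  ∑ b ∈ box q, if IsCoprime b q then f b else 0

theorem isCoprime_congr {m r s : GaussianInt} (h : m ∣ r - s) :
    IsCoprime r m ↔ IsCoprime s m := by
  obtain ⟨k, hk⟩ := h
  rw [eq_add_of_sub_eq hk, add_comm]
  exact IsCoprime.add_mul_left_left_iff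

theorem PeriodicMod.ite_isCoprime {m : GaussianInt} {f : GaussianInt → ℂ}
    (hf : PeriodicMod m f) : PeriodicMod m (fun b => if IsCoprime b m then f b else 0) := by
  intro r s h
  simp only [isCoprime_congr h, hf r s h]

theorem PeriodicMod.mono {m q : GaussianInt} {f : GaussianInt → ℂ}
    (hf : PeriodicMod m f) (h : m ∣ q) : PeriodicMod q f :=
  fun r s hrs => hf r s (h.trans hrs)

theorem redSum_mul_left {q : GaussianInt} (hq : q ≠ 0) {f : GaussianInt → ℂ}
    (hf : PeriodicMod q f) {u : GaussianInt} (hu : IsCoprime u q) :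
    redSum q (fun b => f (u * b)) = redSum q f := by
  rw [redSum, redSum, ← sum_box_mul hq hf.ite_isCoprime hu]
  simp only [IsCoprime.mul_left_iff, hu, true_and]

/-- Removing the multiples of the prime `p` from the residues coprime to `m`. -/
theorem redSum_prime_mul {p m : GaussianInt} (hp : Prime p) (hm : m ≠ 0)
    {f : GaussianInt → ℂ} (hf : PeriodicMod (p * m) f) :
    redSum (p * m) f = (∑ b ∈ box (p * m), if IsCoprime b m then f b else 0) -
      if p ∣ m then 0 else redSum m (fun b => f (p * b)) := by
  have hpm := mul_ne_zero hp.ne_zero hm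
  have key : ∀ b : GaussianInt, (if IsCoprime b (p * m) then f b else 0) =
      (if IsCoprime b m then f b else 0) - if p ∣ b ∧ IsCoprime b m then f b else 0 := by
    intro b
    have h : IsCoprime b p ↔ ¬ p ∣ b := by
      rw [isCoprime_comm, hp.irreducible.coprime_iff_not_dvd]
    rw [IsCoprime.mul_right_iff, h]
    by_cases h1 : p ∣ b <;> by_cases h2 : IsCoprime b m <;> simp [h1, h2]
  have hper : PeriodicMod (p * m) (fun b => if p ∣ b ∧ IsCoprime b m then f b else 0) := by
    intro r s h
    have h1 : p ∣ r ↔ p ∣ s := dvd_iff_dvd_of_dvd_sub (dvd_of_mul_right_dvd h)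
    simp only [isCoprime_congr (dvd_of_mul_left_dvd h), hf r s h, h1]
  rw [redSum, Finset.sum_congr rfl (fun b _ => key b), Finset.sum_sub_distrib,
    ← sum_eq_sum_box hpm hper (box m) (p * ·)]
  · congr 1
    split_ifs with h
    · refine Finset.sum_eq_zero fun b _ => if_neg fun hb => ?_
      exact hp.not_isUnit ((hb.2.of_mul_left_left).isUnit_of_dvd' dvd_rfl h)
    · have hc : IsCoprime p m := hp.irreducible.coprime_iff_not_dvd.2 h
      simp only [redSum, dvd_mul_right, true_and, IsCoprime.mul_left_iff, hc]
  · intro i hi j hj h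
    simp only [← mul_sub] at h
    exact eq_of_mem_box_of_dvd_sub hm hi hj ((mul_dvd_mul_iff_left hp.ne_zero).1 h)
  · intro r hr
    have hr' : p ∣ r ∧ IsCoprime r m := by
      by_contra hcon
      exact hr (if_neg hcon)
    obtain ⟨k, rfl⟩ := hr'.1
    obtain ⟨b, hb, h⟩ := exists_mem_box_dvd_sub hm k
    exact ⟨b, hb, by rw [← mul_sub]; exact mul_dvd_mul_left p h⟩

theorem redSum_prime_mul_of_periodic {p m : GaussianInt} (hp : Prime p) (hm : m ≠ 0)
    {f : GaussianInt → ℂ} (hf : PeriodicMod m f) :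
    redSum (p * m) f = ((box p).card - if p ∣ m then 0 else 1) * redSum m f := by
  rw [redSum_prime_mul hp hm (hf.mono (dvd_mul_left m p)),
    sum_box_prod hp.ne_zero hm hf.ite_isCoprime]
  split_ifs with h
  · rw [redSum]; ring
  · rw [redSum_mul_left hm hf (hp.irreducible.coprime_iff_not_dvd.2 h), redSum]; ring

theorem redSum_unit_mul {u m : GaussianInt} (hu : IsUnit u) (hm : m ≠ 0)
    {f : GaussianInt → ℂ} (hf : PeriodicMod m f) : redSum (u * m) f = redSum m f := by
  have h : ∀ b : GaussianInt, IsCoprime b (u * m) ↔ IsCoprime b m :=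
    fun b => isCoprime_mul_unit_left_right hu b m
  have hd : u * m ∣ m := (hu.mul_left_dvd).2 dvd_rfl
  simp only [redSum, h]
  symm
  apply sum_eq_sum_box (mul_ne_zero hu.ne_zero hm)
    (hf.ite_isCoprime.mono (dvd_mul_left m u)) (box m) id
  · intro i hi j hj hij
    exact eq_of_mem_box_of_dvd_sub hm hi hj (dvd_of_mul_left_dvd hij)
  · intro r _
    obtain ⟨b, hb, hr⟩ := exists_mem_box_dvd_sub hm r
    exact ⟨b, hb, hd.trans hr⟩

theorem periodicMod_const (q : GaussianInt) (c : ℂ) : PeriodicMod q (fun _ => c) :=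
  fun _ _ _ => rfl

/-- Averages over reduced residues do not change when the modulus is enlarged. -/
theorem redSum_mul_redSum_one {d m : GaussianInt} (hd : d ≠ 0) (hm : m ≠ 0)
    {f : GaussianInt → ℂ} (hf : PeriodicMod m f) :
    redSum (d * m) f * redSum m (fun _ => 1) =
      redSum m f * redSum (d * m) (fun _ => 1) := by
  induction d using UniqueFactorizationMonoid.induction_on_prime with
  | h₁ => exact absurd rfl hd
  | h₂ u hu =>
    rw [redSum_unit_mul hu hm hf, redSum_unit_mul hu hm (periodicMod_const m 1)]
  | h₃ d p hd' hp ih =>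
    have hdm := mul_ne_zero hd' hm
    rw [mul_assoc, redSum_prime_mul_of_periodic hp hdm (hf.mono (dvd_mul_left m d)),
      redSum_prime_mul_of_periodic hp hdm (periodicMod_const _ 1)]
    linear_combination (((box p).card : ℂ) - if p ∣ d * m then 0 else 1) * ih hd'

/-- The additive character `n ↦ e(Re (n / q))` modulo `q`. -/
def gchar (q n : GaussianInt) : ℂ := e2 (toComplex n / toComplex q).re

theorem e2_add (s t : ℝ) : e2 (s + t) = e2 s * e2 t := by
  rw [e2, e2, e2, ← Complex.exp_add]; push_cast; ring_nf

theorem e2_eq_one_iff {t : ℝ} : e2 t = 1 ↔ ∃ n : ℤ, t = n := by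
  rw [e2, Complex.exp_eq_one_iff]
  refine exists_congr fun n => ?_
  rw [mul_comm, mul_left_inj' (by simp [Real.pi_ne_zero] : (2 * Real.pi * Complex.I : ℂ) ≠ 0)]
  exact_mod_cast Iff.rfl

theorem gchar_add (q a b : GaussianInt) : gchar q (a + b) = gchar q a * gchar q b := by
  rw [gchar, toComplex_add, add_div, Complex.add_re, e2_add, gchar, gchar]

theorem gchar_mul_self {q : GaussianInt} (hq : q ≠ 0) (k : GaussianInt) :
    gchar q (q * k) = 1 := by
  rw [gchar, toComplex_mul, mul_div_cancel_left₀ _ (toComplex_eq_zero.not.2 hq), e2_eq_one_iff]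
  exact ⟨k.re, by simp⟩

theorem gchar_mul_mul {d : GaussianInt} (hd : d ≠ 0) (m n : GaussianInt) :
    gchar (d * m) (d * n) = gchar m n := by
  rw [gchar, toComplex_mul, toComplex_mul, mul_div_mul_left _ _ (toComplex_eq_zero.not.2 hd),
    gchar]

theorem periodicMod_gchar {q : GaussianInt} (hq : q ≠ 0) : PeriodicMod q (gchar q) := by
  rintro r s ⟨k, hk⟩
  rw [eq_add_of_sub_eq hk, gchar_add, gchar_mul_self hq, one_mul]

theorem exists_gchar_ne_one {q : GaussianInt} (hq : q ≠ 0) (hu : ¬ IsUnit q) :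
    ∃ t, gchar q t ≠ 1 := by
  by_contra! h
  obtain ⟨a, ha⟩ := e2_eq_one_iff.1 (h 1)
  obtain ⟨b, hb⟩ := e2_eq_one_iff.1 (h ⟨0, -1⟩)
  apply hu
  refine IsUnit.of_mul_eq_one (⟨a, b⟩ : GaussianInt) ?_
  rw [← toComplex_inj, toComplex_mul, toComplex_one]
  have hq' := toComplex_eq_zero.not.2 hq
  have h1 : toComplex (⟨a, b⟩ : GaussianInt) = 1 / toComplex q := by
    apply Complex.ext
    · rw [re_toComplex, ← ha, toComplex_one]
    · rw [im_toComplex, ← hb, toComplex_def' 0 (-1)]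
      simp [div_eq_mul_inv]
  rw [h1, mul_one_div_cancel hq']

theorem sum_box_isCoprime_gchar {p m : GaussianInt} (hp : Prime p) (hm : m ≠ 0) :
    (∑ b ∈ box (p * m), if IsCoprime b m then gchar (p * m) b else 0) = 0 := by
  have hpm := mul_ne_zero hp.ne_zero hm
  obtain ⟨t, ht⟩ := exists_gchar_ne_one hp.ne_zero hp.not_isUnit
  have hper : PeriodicMod (p * m) (fun b => if IsCoprime b m then gchar (p * m) b else 0) := by
    intro r s h
    simp only [isCoprime_congr (dvd_of_mul_left_dvd h), periodicMod_gchar hpm r s h]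
  have hshift := sum_box_add hpm hper (m * t)
  have hterm : ∀ b : GaussianInt, (if IsCoprime (b + m * t) m then gchar (p * m) (b + m * t)
      else 0) = gchar p t * if IsCoprime b m then gchar (p * m) b else 0 := by
    intro b
    have h1 : IsCoprime (b + m * t) m ↔ IsCoprime b m := isCoprime_congr ⟨t, by ring⟩
    rw [gchar_add, mul_comm p m, gchar_mul_mul hm]
    simp only [h1, mul_ite, mul_zero, mul_comm]
  simp only [hterm, ← Finset.mul_sum] at hshift
  by_contra hne
  exact ht (mul_right_cancel₀ hne (by rw [hshift, one_mul]))

theorem redSum_gchar_prime_mul {p m : GaussianInt} (hp : Prime p) (hm : m ≠ 0) :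
    redSum (p * m) (gchar (p * m)) = if p ∣ m then 0 else -redSum m (gchar m) := by
  rw [redSum_prime_mul hp hm (periodicMod_gchar (mul_ne_zero hp.ne_zero hm)),
    sum_box_isCoprime_gchar hp hm]
  simp only [gchar_mul_mul hp.ne_zero]
  split_ifs <;> simp

theorem gmu_of_isUnit {u : GaussianInt} (hu : IsUnit u) : gmu u = 1 := by
  rw [gmu, if_pos ⟨hu.ne_zero, hu.squarefree⟩, UniqueFactorizationMonoid.factors_of_isUnit hu]
  simp

theorem gmu_prime_mul {p m : GaussianInt} (hp : Prime p) (hm : m ≠ 0) :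
    gmu (p * m) = if p ∣ m then 0 else -gmu m := by
  have hpm := mul_ne_zero hp.ne_zero hm
  have hsq : Squarefree (p * m) ↔ ¬ p ∣ m ∧ Squarefree m := by
    rw [squarefree_mul_iff, isRelPrime_iff_isCoprime, hp.irreducible.coprime_iff_not_dvd]
    simp [hp.irreducible.squarefree]
  have hcard : (UniqueFactorizationMonoid.factors (p * m)).card =
      (UniqueFactorizationMonoid.factors m).card + 1 := by
    obtain ⟨p', -, hp'⟩ :=
      UniqueFactorizationMonoid.factors_eq_singleton_of_irreducible hp.irreducible
    rw [Multiset.card_eq_card_of_rel (UniqueFactorizationMonoid.factors_mul hp.ne_zero hm),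
      Multiset.card_add, hp', Multiset.card_singleton, add_comm]
  by_cases h : p ∣ m
  · simp [gmu, hsq, h]
  · by_cases h2 : Squarefree m
    · simp [gmu, hsq, h, h2, hpm, hm, hcard, pow_succ]
    · simp [gmu, hsq, h, h2]

theorem tsum_Aq_eq_redSum {q : GaussianInt} (hq : q ≠ 0) (f : GaussianInt → ℂ) :
    ∑' n : Aq q, f n = redSum q f := by
  have hA : Aq q = ↑((box q).filter (fun b => IsCoprime b q)) := by
    ext r
    simp [Aq, mem_box hq, EuclideanDomain.gcd_isUnit_iff]
  rw [hA, redSum, ← Finset.sum_filter]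
  exact Finset.tsum_subtype _ f

theorem gphi_eq_redSum {q : GaussianInt} (hq : q ≠ 0) :
    (gphi q : ℂ) = redSum q (fun _ => 1) := by
  rw [← tsum_Aq_eq_redSum hq, tsum_const, gphi]
  simp

theorem gtau_eq_redSum {q : GaussianInt} (hq : q ≠ 0) (x : GaussianInt) :
    gtau q x = redSum q (fun n => gchar q (star x * n)) := by
  rw [← tsum_Aq_eq_redSum hq, gtau]
  refine tsum_congr fun n => ?_
  rw [gchar, toComplex_mul, mul_div_assoc, toComplex_star, cip]
  simp

theorem gphi_ne_zero {q : GaussianInt} (hq : q ≠ 0) : gphi q ≠ 0 := by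
  have hfin : (Aq q).Finite := (finite_Bq hq).subset fun r hr => hr.1
  have hmem : boxRep q 1 ∈ Aq q :=
    ⟨boxRep_mem hq 1, EuclideanDomain.gcd_isUnit_iff.2
      ((isCoprime_congr (dvd_sub_boxRep q 1)).1 isCoprime_one_left)⟩
  have := hfin.to_subtype
  have : Nonempty (Aq q) := ⟨⟨_, hmem⟩⟩
  exact Nat.card_pos.ne'

theorem redSum_gchar_eq_gmu {m : GaussianInt} (hm : m ≠ 0) :
    redSum m (gchar m) = gmu m := by
  induction m using UniqueFactorizationMonoid.induction_on_prime with
  | h₁ => exact absurd rfl hm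
  | h₂ u hu =>
    have hB : box 1 = {0} := by
      ext r
      rw [mem_box one_ne_zero, mem_Bq_iff, Finset.mem_singleton, Zsqrtd.ext_iff]
      simp
      omega
    have hone : ∀ n, gchar u n = 1 := fun n => by
      obtain ⟨k, rfl⟩ := hu.dvd (a := n)
      exact gchar_mul_self hm k
    have h1 := redSum_unit_mul hu one_ne_zero (periodicMod_const 1 1)
    rw [mul_one] at h1
    rw [gmu_of_isUnit hu, funext hone, h1, redSum, hB]
    simp [isCoprime_one_right]
  | h₃ m p hm' hp ih =>
    rw [redSum_gchar_prime_mul hp hm', gmu_prime_mul hp hm', ih hm']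
    split_ifs <;> simp

theorem gtau_closed_formula (q : GaussianInt) (hq : q ≠ 0) (x : GaussianInt) :
    gtau q x = (gmu (q / EuclideanDomain.gcd q (star x)) : ℂ) * (gphi q : ℂ) /
        (gphi (q / EuclideanDomain.gcd q (star x)) : ℂ) := by
  set d := EuclideanDomain.gcd q (star x) with hd_def
  obtain ⟨m, hm⟩ : d ∣ q := EuclideanDomain.gcd_dvd_left _ _
  obtain ⟨y, hy⟩ : d ∣ star x := EuclideanDomain.gcd_dvd_right _ _
  have hd : d ≠ 0 := by rintro h; exact hq (by rw [hm, h, zero_mul])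
  have hm0 : m ≠ 0 := by rintro rfl; exact hq (by rw [hm, mul_zero])
  have hcop : IsCoprime y m := by
    obtain ⟨a, b, hab⟩ : ∃ a b, d = q * a + star x * b :=
      ⟨_, _, EuclideanDomain.gcd_eq_gcd_ab q (star x)⟩
    refine ⟨b, a, mul_left_cancel₀ hd ?_⟩
    rw [hy] at hab
    linear_combination -hab - a * hm
  have hquot : q / d = m := by
    rw [hm, mul_div_cancel_left₀ _ hd]
  have hsum : gtau q x = redSum (d * m) (fun n => gchar m (y * n)) := by
    rw [gtau_eq_redSum hq, hy, ← hm]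
    congr 1
    funext n
    rw [mul_assoc]
    conv_lhs => rw [hm]
    exact gchar_mul_mul hd _ _
  have hper : PeriodicMod m (fun n => gchar m (y * n)) := fun r s h =>
    periodicMod_gchar hm0 _ _ (by rw [← mul_sub]; exact h.mul_left y)
  have hphi : (gphi m : ℂ) ≠ 0 := Nat.cast_ne_zero.2 (gphi_ne_zero hm0)
  rw [hquot, eq_div_iff hphi, hsum, gphi_eq_redSum hm0, redSum_mul_redSum_one hd hm0 hper,
    redSum_mul_left hm0 (periodicMod_gchar hm0) hcop, redSum_gchar_eq_gmu hm0, ← hm,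
    gphi_eq_redSum hq]

end
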